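/- arXiv:0905.2613 — 3 statements merged into one kernel-verified Lean document; each statement's English description precedes it below -/
import Mathlib

section
/- Let k be a field, let H be a bialgebra over k, and let S : H → H be a k-linear map which is an algebra antihomomorphism, i.e. S(1) = 1 and S(xy) = S(y)S(x) for all x, y ∈ H. Then the set of elements h ∈ H satisfying both antipode identities ∑ h_(1) S(h_(2)) = ε(h)·1 and ∑ S(h_(1)) h_(2) = ε(h)·1 contains 1 and is closed under multiplication. Consequently, if these identities hold on a subset that generates H as an algebra, then S is an antipode for H and H is a Hopf algebra. -/
universe u

open TensorProduct Coalgebra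

variable (k : Type u) [Field k]

/-- For a bialgebra `H` over `k` and a linear map `S : H → H`, `AntipodeAt k S h` says that both
antipode identities `∑ h₍₁₎ S(h₍₂₎) = ε(h)·1` and `∑ S(h₍₁₎) h₍₂₎ = ε(h)·1` hold at the element
`h`. -/
def AntipodeAt {H : Type u} [Ring H] [Bialgebra k H] (S : H →ₗ[k] H) (h : H) : Prop :=
  LinearMap.mul' k H (S.rTensor H (Coalgebra.comul h)) = algebraMap k H (Coalgebra.counit h) ∧
    LinearMap.mul' k H (S.lTensor H (Coalgebra.comul h)) = algebraMap k H (Coalgebra.counit h)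

/-- Left identity on tensors. -/
lemma mul_rTensor_mul_tmul {H : Type u} [Ring H] [Bialgebra k H]
    (S : H →ₗ[k] H) (hSmul : ∀ x y : H, S (x * y) = S y * S x) (s : H ⊗[k] H) (a b : H) :
    LinearMap.mul' k H (S.rTensor H (s * a ⊗ₜ[k] b)) =
      S a * LinearMap.mul' k H (S.rTensor H s) * b := by
  induction s using TensorProduct.induction_on with
  | zero => simp
  | tmul c d => simp [hSmul, mul_assoc]
  | add p q hp hq => simp only [add_mul, mul_add, map_add, hp, hq]

lemma mul_lTensor_tmul_mul {H : Type u} [Ring H] [Bialgebra k H]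
    (S : H →ₗ[k] H) (hSmul : ∀ x y : H, S (x * y) = S y * S x) (t : H ⊗[k] H) (a b : H) :
    LinearMap.mul' k H (S.lTensor H (a ⊗ₜ[k] b * t)) =
      a * LinearMap.mul' k H (S.lTensor H t) * S b := by
  induction t using TensorProduct.induction_on with
  | zero => simp
  | tmul c d => simp [hSmul, mul_assoc]
  | add p q hp hq => simp only [add_mul, mul_add, map_add, hp, hq]

lemma mul_rTensor_mul {H : Type u} [Ring H] [Bialgebra k H]
    (S : H →ₗ[k] H) (hSmul : ∀ x y : H, S (x * y) = S y * S x) (s t : H ⊗[k] H) (c : k)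
    (hs : LinearMap.mul' k H (S.rTensor H s) = algebraMap k H c) :
    LinearMap.mul' k H (S.rTensor H (s * t)) =
      algebraMap k H c * LinearMap.mul' k H (S.rTensor H t) := by
  induction t using TensorProduct.induction_on with
  | zero => simp
  | tmul a b =>
    rw [mul_rTensor_mul_tmul k S hSmul, hs, ← Algebra.commutes]
    simp [mul_assoc]
  | add p q hp hq => simp only [mul_add, map_add, hp, hq]

lemma mul_lTensor_mul {H : Type u} [Ring H] [Bialgebra k H]
    (S : H →ₗ[k] H) (hSmul : ∀ x y : H, S (x * y) = S y * S x) (s t : H ⊗[k] H) (c : k)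
    (ht : LinearMap.mul' k H (S.lTensor H t) = algebraMap k H c) :
    LinearMap.mul' k H (S.lTensor H (s * t)) =
      LinearMap.mul' k H (S.lTensor H s) * algebraMap k H c := by
  induction s using TensorProduct.induction_on with
  | zero => simp
  | tmul a b =>
    rw [mul_lTensor_tmul_mul k S hSmul, ht, mul_assoc, Algebra.commutes]
    simp [mul_assoc]
  | add p q hp hq => simp only [add_mul, map_add, hp, hq]

/-- **Checking the antipode identities on algebra generators.**
Let `H` be a bialgebra over a field `k` and `S : H → H` a `k`-linear algebra
antihomomorphism (`S(1) = 1` and `S(xy) = S(y)S(x)`).  Then the set of elements of `H`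
satisfying both antipode identities contains `1` and is closed under multiplication.
Consequently, if the identities hold on a subset generating `H` as an algebra, then they hold
on all of `H`, i.e. `S` is an antipode and `H` is a Hopf algebra (with its given bialgebra
structure and antipode `S`). -/
theorem antipode_of_antipodeAt_generators {H : Type u} [Ring H] [instH : Bialgebra k H]
    (S : H →ₗ[k] H) (hS1 : S 1 = 1) (hSmul : ∀ x y : H, S (x * y) = S y * S x) :
    AntipodeAt k S (1 : H) ∧
      (∀ x y : H, AntipodeAt k S x → AntipodeAt k S y → AntipodeAt k S (x * y)) ∧
      ∀ X : Set H, Algebra.adjoin k X = ⊤ → (∀ x ∈ X, AntipodeAt k S x) →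
        (∀ h : H, AntipodeAt k S h) ∧
          ∃ hopf : HopfAlgebra k H, hopf.toBialgebra = instH ∧ ∀ h : H, hopf.antipode h = S h := by
  have h1 : AntipodeAt k S (1 : H) := by
    constructor <;> simp [Algebra.TensorProduct.one_def, hS1]
  have hm : ∀ x y : H, AntipodeAt k S x → AntipodeAt k S y → AntipodeAt k S (x * y) := by
    intro x y hx hy
    constructor
    · rw [Bialgebra.comul_mul, mul_rTensor_mul k S hSmul _ _ _ hx.1, hy.1, Bialgebra.counit_mul,
        map_mul]
    · rw [Bialgebra.comul_mul, mul_lTensor_mul k S hSmul _ _ _ hy.2, hx.2, Bialgebra.counit_mul,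
        map_mul]
  refine ⟨h1, hm, fun X hX hXS => ?_⟩
  have hall : ∀ h : H, AntipodeAt k S h := by
    intro h
    have hh : h ∈ Algebra.adjoin k X := hX ▸ Algebra.mem_top
    induction hh using Algebra.adjoin_induction with
    | mem x hx => exact hXS x hx
    | algebraMap r =>
      rw [Algebra.algebraMap_eq_smul_one]
      constructor
      · simp only [map_smul, h1.1]
        simp [Algebra.smul_def]
      · simp only [map_smul, h1.2]
        simp [Algebra.smul_def]
    | add x y _ _ hx hy =>
      constructor
      · simp only [map_add, hx.1, hy.1]
      · simp only [map_add, hx.2, hy.2]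
    | mul x y _ _ hx hy => exact hm x y hx hy
  refine ⟨hall, { instH with
    antipode := S
    mul_antipode_rTensor_comul := LinearMap.ext fun h => (hall h).1
    mul_antipode_lTensor_comul := LinearMap.ext fun h => (hall h).2 }, rfl, fun _ => rfl⟩
end

section
/- Let k be a field. The category of bialgebras over k has all (small) coproducts: for any family (A_l)_{l ∈ I} of bialgebras over k there exists a coproduct of the family in k-BiAlg, whose underlying algebra is the coproduct of the underlying algebras, namely the quotient of the tensor algebra T(⊕_{l ∈ I} A_l) by the ideal imposing the algebra relations of each A_l. -/
universe u

open LinearAlgebra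

/-- `(C, (q l))` is a coproduct of the family `(A l)` of bialgebras in the category of
`k`-bialgebras: for every bialgebra `D` and every family of bialgebra maps `f l : A l → D`
there is a unique bialgebra map `F : C → D` with `F ∘ q l = f l` for all `l`. -/
def IsBialgCoproduct (k : Type u) [Field k] {ι : Type u} (A : ι → Type u)
    [∀ l, Ring (A l)] [∀ l, Bialgebra k (A l)] {C : Type u} [Semiring C] [Bialgebra k C]
    (q : ∀ l : ι, A l →ₐc[k] C) : Prop :=
  ∀ (D : Type u) [Ring D] [Bialgebra k D] (f : ∀ l : ι, A l →ₐc[k] D),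
    ∃! F : C →ₐc[k] D, ∀ l : ι, F.comp (q l) = f l

open TensorProduct in
theorem bialgCoproduct_aux (k : Type u) [Field k] {ι : Type u}
    (A : ι → Type u) [∀ l, Ring (A l)] [∀ l, Bialgebra k (A l)]
    (C : Type u) [Semiring C] [instA : Algebra k C] (i : ∀ l, A l →ₐ[k] C)
    (hlift : ∀ (B : Type u) [Semiring B] [Algebra k B] (f : ∀ l, A l →ₐ[k] B),
      ∃ F : C →ₐ[k] B, ∀ l, F.comp (i l) = f l)
    (hext : ∀ (B : Type u) [Semiring B] [Algebra k B] (F G : C →ₐ[k] B),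
      (∀ l, F.comp (i l) = G.comp (i l)) → F = G) :
    ∃ instB : Bialgebra k C,
      instB.toAlgebra = instA ∧
      ∃ q : ∀ l : ι, @BialgHom k (A l) C _ _ _ _ instB.toAlgebra _
          instB.toCoalgebra.toCoalgebraStruct,
        (∀ (l : ι) (x : A l), q l x = i l x) ∧
        @IsBialgCoproduct k _ ι A _ _ C _ instB q := by
  obtain ⟨Δ, hΔ⟩ := hlift (C ⊗[k] C) fun l =>
    (Algebra.TensorProduct.map (i l) (i l)).comp (Bialgebra.comulAlgHom k (A l))
  obtain ⟨ε, hε⟩ := hlift k fun l => Bialgebra.counitAlgHom k (A l)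
  have hΔ' : ∀ l x, Δ (i l x) = Algebra.TensorProduct.map (i l) (i l)
      (Coalgebra.comul (R := k) x) := fun l x => DFunLike.congr_fun (hΔ l) x
  have hε' : ∀ l x, ε (i l x) = Coalgebra.counit (R := k) x :=
    fun l x => DFunLike.congr_fun (hε l) x
  have h1 : (Algebra.TensorProduct.assoc k k k C C C).toAlgHom.comp
      ((Algebra.TensorProduct.map Δ (.id k C)).comp Δ)
      = (Algebra.TensorProduct.map (.id k C) Δ).comp Δ := by
    refine hext _ _ _ fun l => ?_
    have e1 : (Algebra.TensorProduct.assoc k k k C C C).toAlgHom.comp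
        ((Algebra.TensorProduct.map Δ (.id k C)).comp (Algebra.TensorProduct.map (i l) (i l)))
        = (Algebra.TensorProduct.map (i l) (Algebra.TensorProduct.map (i l) (i l))).comp
          ((Algebra.TensorProduct.assoc k k k (A l) (A l) (A l)).toAlgHom.comp
          (Algebra.TensorProduct.map (Bialgebra.comulAlgHom k (A l)) (.id k (A l)))) := by
      have e0 : ∀ (t : A l ⊗[k] A l) (y : A l),
          Algebra.TensorProduct.assoc k k k C C C
            ((Algebra.TensorProduct.map (i l) (i l) t) ⊗ₜ i l y) =
          Algebra.TensorProduct.map (i l) (Algebra.TensorProduct.map (i l) (i l))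
            (Algebra.TensorProduct.assoc k k k (A l) (A l) (A l) (t ⊗ₜ y)) := by
        intro t y
        induction t with
        | zero => simp
        | tmul a b => simp
        | add a b ha hb => simp only [map_add, TensorProduct.add_tmul, ha, hb]
      apply Algebra.TensorProduct.ext'
      intro a b
      simpa [hΔ'] using e0 _ _
    have e2 : (Algebra.TensorProduct.map (.id k C) Δ).comp (Algebra.TensorProduct.map (i l) (i l))
        = (Algebra.TensorProduct.map (i l) (Algebra.TensorProduct.map (i l) (i l))).comp
          (Algebra.TensorProduct.map (.id k (A l)) (Bialgebra.comulAlgHom k (A l))) := by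
      apply Algebra.TensorProduct.ext'
      intro a b
      simp [hΔ']
    ext x
    have a1 := DFunLike.congr_fun e1 (Coalgebra.comul (R := k) x)
    have a2 := DFunLike.congr_fun e2 (Coalgebra.comul (R := k) x)
    have a3 := Coalgebra.coassoc_apply (R := k) x
    simp only [AlgHom.comp_apply, hΔ'] at a1 a2 ⊢
    refine a1.trans (Eq.trans ?_ a2.symm)
    exact congrArg _ a3
  have h2 : (Algebra.TensorProduct.map ε (.id k C)).comp Δ
      = (Algebra.TensorProduct.lid k C).symm := by
    refine hext _ _ _ fun l => ?_
    have e1 : (Algebra.TensorProduct.map ε (.id k C)).comp (Algebra.TensorProduct.map (i l) (i l))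
        = (Algebra.TensorProduct.map (.id k k) (i l)).comp
          (Algebra.TensorProduct.map (Bialgebra.counitAlgHom k (A l)) (.id k (A l))) := by
      apply Algebra.TensorProduct.ext'
      intro a b
      simp [hε']
    ext x
    have a1 := DFunLike.congr_fun e1 (Coalgebra.comul (R := k) x)
    have a3 := Coalgebra.rTensor_counit_comul (R := k) x
    simp only [AlgHom.comp_apply, hΔ'] at a1 ⊢
    refine a1.trans ((congrArg _ a3).trans ?_)
    simp
  have h3 : (Algebra.TensorProduct.map (.id k C) ε).comp Δ
      = (Algebra.TensorProduct.rid k k C).symm := by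
    refine hext _ _ _ fun l => ?_
    have e1 : (Algebra.TensorProduct.map (.id k C) ε).comp (Algebra.TensorProduct.map (i l) (i l))
        = (Algebra.TensorProduct.map (i l) (.id k k)).comp
          (Algebra.TensorProduct.map (.id k (A l)) (Bialgebra.counitAlgHom k (A l))) := by
      apply Algebra.TensorProduct.ext'
      intro a b
      simp [hε']
    ext x
    have a1 := DFunLike.congr_fun e1 (Coalgebra.comul (R := k) x)
    have a3 := Coalgebra.lTensor_counit_comul (R := k) x
    simp only [AlgHom.comp_apply, hΔ'] at a1 ⊢
    refine a1.trans ((congrArg _ a3).trans ?_)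
    simp
  letI instB : Bialgebra k C := Bialgebra.ofAlgHom Δ ε h1 h2 h3
  refine ⟨instB, rfl, fun l => BialgHom.ofAlgHom (i l) (hε l) (hΔ l).symm, fun l x => rfl, ?_⟩
  intro D _ _ f
  obtain ⟨F, hF⟩ := hlift D fun l => (f l : A l →ₐ[k] D)
  have hF' : ∀ l x, F (i l x) = f l x := fun l x => DFunLike.congr_fun (hF l) x
  have c1 : (Bialgebra.counitAlgHom k D).comp F = ε := by
    refine hext _ _ _ fun l => ?_
    rw [hε, AlgHom.comp_assoc, hF]
    exact BialgHom.counitAlgHom_comp (f l)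
  have c2 : (Algebra.TensorProduct.map F F).comp Δ = (Bialgebra.comulAlgHom k D).comp F := by
    refine hext _ _ _ fun l => ?_
    rw [AlgHom.comp_assoc, AlgHom.comp_assoc, hΔ, hF, ← AlgHom.comp_assoc,
      ← Algebra.TensorProduct.map_comp, hF]
    exact BialgHom.map_comp_comulAlgHom (f l)
  refine ⟨BialgHom.ofAlgHom F c1 c2, fun l => BialgHom.ext fun x => hF' l x, ?_⟩
  intro G hG
  have : (G : C →ₐ[k] D) = F := by
    refine hext _ _ _ fun l => ?_
    rw [hF]
    ext x
    exact DFunLike.congr_fun (hG l) x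
  ext x
  exact DFunLike.congr_fun this x

/-- **Coproducts of bialgebras.**
For any family `(A l)` of bialgebras over a field `k`, the free product of the underlying
algebras — i.e. the quotient of the tensor algebra `T(⊕ l, A l)` by the ideal imposing the
algebra relations of each `A l`, which is the coproduct of the underlying algebras — carries
a bialgebra structure (extending its algebra structure) such that the canonical injections
`q l : A l → C` are bialgebra maps and `(C, (q l))` is the coproduct of the family in the
category of `k`-bialgebras. -/
theorem bialgebra_coproducts (k : Type u) [Field k] {ι : Type u} [DecidableEq ι]
    (A : ι → Type u) [∀ l, Ring (A l)] [∀ l, Bialgebra k (A l)] :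
    ∃ instB : Bialgebra k (FreeProduct k A),
      instB.toAlgebra = FreeProduct.instAlgebra k A ∧
      ∃ q : ∀ l : ι, @BialgHom k (A l) (FreeProduct k A) _ _ _ _ instB.toAlgebra _
          instB.toCoalgebra.toCoalgebraStruct,
        (∀ (l : ι) (x : A l), q l x = FreeProduct.ι k A l x) ∧
        @IsBialgCoproduct k _ ι A _ _ (FreeProduct k A) _ instB q := by
  refine bialgCoproduct_aux k A (FreeProduct k A) (FreeProduct.ι k A) ?_ ?_
  · intro B _ _ f
    exact ⟨FreeProduct.lift k A (fun {l} => f l), fun l =>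
      FreeProduct.lift_comp_ι k A (fun {l} => f l)⟩
  · intro B _ _ F G h
    apply (FreeProduct.lift k A).symm.injective
    funext l
    exact h l
end

section
/- Let k be a field, let (H_l)_{l ∈ I} be a family of Hopf algebras over k with antipodes S_l, and let (H, (q_l)_{l ∈ I}) be the coproduct of the family of underlying bialgebras in the category of bialgebras over k. Then the unique bialgebra map S : H → H^{op,cop} satisfying S ∘ q_l = q_l ∘ S_l for all l ∈ I is an antipode for the bialgebra H, i.e. m ∘ (id ⊗ S) ∘ Δ = m ∘ (S ⊗ id) ∘ Δ = η ∘ ε on H, so H is a Hopf algebra. -/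
universe u

open TensorProduct

section Helpers

open Coalgebra Bialgebra

variable {k : Type u} [Field k]

theorem atmap_injective {A B C D : Type u} [Ring A] [Ring B] [Ring C] [Ring D]
    [Algebra k A] [Algebra k B] [Algebra k C] [Algebra k D]
    (f : A →ₐ[k] C) (g : B →ₐ[k] D) (hf : Function.Injective f) (hg : Function.Injective g) :
    Function.Injective (Algebra.TensorProduct.map f g) :=
  TensorProduct.map_injective_of_flat_flat f.toLinearMap g.toLinearMap hf hg

variable {H : Type u} [Ring H] [Bialgebra k H]

/-- The bialgebra structure transported to an algebra embedded in `H`, when the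
comultiplication restricts. -/
noncomputable abbrev subBialg {B : Type u} [Ring B] [Algebra k B] (i : B →ₐ[k] H)
    (hi : Function.Injective i) (δ : B →ₐ[k] B ⊗[k] B)
    (hδ : (Algebra.TensorProduct.map i i).comp δ = (comulAlgHom k H).comp i) :
    Bialgebra k B :=
  Bialgebra.ofAlgHom δ ((counitAlgHom k H).comp i)
    (by
      have hinj := atmap_injective i (Algebra.TensorProduct.map i i) hi (atmap_injective i i hi hi)
      ext b
      apply hinj
      have hδ' : ∀ b, Algebra.TensorProduct.map i i (δ b) = comul (R := k) (i b) :=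
        fun b => DFunLike.congr_fun hδ b
      have h1 : ∀ t : B ⊗[k] B, Algebra.TensorProduct.map i (Algebra.TensorProduct.map i i)
          (Algebra.TensorProduct.assoc k k k B B B
            (Algebra.TensorProduct.map δ (AlgHom.id k B) t)) =
          TensorProduct.assoc k H H H
            (comul.rTensor H (Algebra.TensorProduct.map i i t)) := by
        intro t
        induction t with
        | zero => simp
        | add x y hx hy => simp only [map_add, hx, hy]
        | tmul x y =>
          simp only [Algebra.TensorProduct.map_tmul, LinearMap.rTensor_tmul, ← hδ',
            AlgHom.id_apply]
          generalize δ x = s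
          induction s with
          | zero => simp
          | add x y hx hy => simp only [map_add, add_tmul, hx, hy]
          | tmul a c => simp
      have h2 : ∀ t : B ⊗[k] B, Algebra.TensorProduct.map i (Algebra.TensorProduct.map i i)
            (Algebra.TensorProduct.map (AlgHom.id k B) δ t) =
            comul.lTensor H (Algebra.TensorProduct.map i i t) := by
        intro t
        induction t with
        | zero => simp
        | add x y hx hy => simp only [map_add, hx, hy]
        | tmul x y => simp [hδ']
      have h3 : TensorProduct.assoc k H H H
          (comul.rTensor H (Algebra.TensorProduct.map i i (δ b))) =
          comul.lTensor H (Algebra.TensorProduct.map i i (δ b)) := by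
        rw [hδ', Coalgebra.coassoc_apply]
      exact (h1 _).trans (h3.trans (h2 _).symm))
    (by
      ext b
      apply atmap_injective (AlgHom.id k k) i (fun _ _ h => h) hi
      have hδ' : ∀ b, Algebra.TensorProduct.map i i (δ b) = comul (R := k) (i b) :=
        fun b => DFunLike.congr_fun hδ b
      have h2 : ∀ t : B ⊗[k] B, Algebra.TensorProduct.map (AlgHom.id k k) i
            (Algebra.TensorProduct.map ((counitAlgHom k H).comp i) (AlgHom.id k B) t) =
            counit.rTensor H (Algebra.TensorProduct.map i i t) := by
        intro t
        induction t with
        | zero => simp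
        | add x y hx hy => simp only [map_add, hx, hy]
        | tmul x y => simp
      have h3 : counit.rTensor H (Algebra.TensorProduct.map i i (δ b)) = 1 ⊗ₜ i b := by
        rw [hδ', Coalgebra.rTensor_counit_comul]
      refine (h2 _).trans (h3.trans ?_)
      simp)
    (by
      ext b
      apply atmap_injective i (AlgHom.id k k) hi (fun _ _ h => h)
      have hδ' : ∀ b, Algebra.TensorProduct.map i i (δ b) = comul (R := k) (i b) :=
        fun b => DFunLike.congr_fun hδ b
      have h2 : ∀ t : B ⊗[k] B, Algebra.TensorProduct.map i (AlgHom.id k k)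
            (Algebra.TensorProduct.map (AlgHom.id k B) ((counitAlgHom k H).comp i) t) =
            counit.lTensor H (Algebra.TensorProduct.map i i t) := by
        intro t
        induction t with
        | zero => simp
        | add x y hx hy => simp only [map_add, hx, hy]
        | tmul x y => simp
      have h3 : counit.lTensor H (Algebra.TensorProduct.map i i (δ b)) = i b ⊗ₜ 1 := by
        rw [hδ', Coalgebra.lTensor_counit_comul]
      refine (h2 _).trans (h3.trans ?_)
      simp)

theorem coprod_generated {ι : Type u} (A : ι → Type u) [∀ l, Ring (A l)]
    [∀ l, Bialgebra k (A l)] (q : ∀ l : ι, A l →ₐc[k] H) (hq : IsBialgCoproduct k A q) :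
    Algebra.adjoin k (⋃ l, Set.range (q l)) = ⊤ := by
  set B := Algebra.adjoin k (⋃ l, Set.range (q l)) with hB
  have hmem : ∀ l x, q l x ∈ B := fun l x =>
    Algebra.subset_adjoin (Set.mem_iUnion.2 ⟨l, x, rfl⟩)
  have hinj : Function.Injective B.val := Subtype.val_injective
  have hinj2 := atmap_injective B.val B.val hinj hinj
  let p : ∀ l, A l →ₐ[k] B := fun l => (q l : A l →ₐ[k] H).codRestrict B (hmem l)
  have hp : ∀ l x, B.val (p l x) = q l x := fun l x => rfl
  have hpt : ∀ l (t : A l ⊗[k] A l), Algebra.TensorProduct.map B.val B.val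
      (Algebra.TensorProduct.map (p l) (p l) t) =
      TensorProduct.map (q l : A l →ₗ[k] H) (q l : A l →ₗ[k] H) t := by
    intro l t
    induction t with
    | zero => simp
    | add x y hx hy => simp only [map_add, hx, hy]
    | tmul x y => simp [hp]
  have hqc : ∀ l x, TensorProduct.map (q l : A l →ₗ[k] H) (q l : A l →ₗ[k] H)
      (comul (R := k) x) = comul (R := k) (q l x) := fun l x =>
    CoalgHomClass.map_comp_comul_apply (q l) x
  have hle : B ≤ (Algebra.TensorProduct.map B.val B.val).range.comap (comulAlgHom k H) := by
    rw [hB]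
    apply Algebra.adjoin_le
    rintro _ ⟨_, ⟨l, rfl⟩, x, rfl⟩
    exact ⟨Algebra.TensorProduct.map (p l) (p l) (comul x), (hpt l _).trans (hqc l x)⟩
  let e := AlgEquiv.ofInjective _ hinj2
  let δ : B →ₐ[k] B ⊗[k] B := (e.symm : _ →ₐ[k] B ⊗[k] B).comp
    (((comulAlgHom k H).comp B.val).codRestrict
      (Algebra.TensorProduct.map B.val B.val).range (fun x => hle x.2))
  have hδ : (Algebra.TensorProduct.map B.val B.val).comp δ = (comulAlgHom k H).comp B.val := by
    ext b
    have := e.apply_symm_apply (⟨comul (R := k) (b : H), hle b.2⟩)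
    exact congrArg Subtype.val this
  letI : Bialgebra k B := subBialg B.val hinj δ hδ
  let j : B →ₐc[k] H := BialgHom.ofAlgHom B.val rfl hδ
  let p' : ∀ l, A l →ₐc[k] B := fun l => BialgHom.ofAlgHom (p l)
    (by ext x; exact CoalgHomClass.counit_comp_apply (q l) x)
    (by
      ext x
      apply hinj2
      refine (hpt l _).trans ((hqc l x).trans ?_)
      exact (DFunLike.congr_fun hδ (p l x)).symm)
  obtain ⟨F, hF, -⟩ := hq B p'
  obtain ⟨G, -, hG⟩ := hq H q
  have h1 : j.comp F = BialgHom.id k H := by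
    rw [hG (j.comp F) ?_, hG (BialgHom.id k H) ?_]
    · intro l; ext x; rfl
    · intro l
      ext x
      have := DFunLike.congr_fun (hF l) x
      exact congrArg j this
  rw [eq_top_iff]
  intro x _
  have : j (F x) = x := DFunLike.congr_fun h1 x
  rw [← this]
  exact (F x).2

end Helpers

/-- **The antipode on a coproduct of Hopf algebras.**
Let `(H l)` be a family of Hopf algebras over a field `k` with antipodes `S l`, and let
`(H, (q l))` be the coproduct of the underlying bialgebras in the category of `k`-bialgebras.
The unique bialgebra map `S : H → H^{op,cop}` satisfying `S ∘ q l = q l ∘ S l` — i.e. the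
`k`-linear map `S : H → H` which is an algebra antihomomorphism (`S 1 = 1`,
`S (x * y) = S y * S x`), a coalgebra antihomomorphism (`ε ∘ S = ε` and
`Δ ∘ S = twist ∘ (S ⊗ S) ∘ Δ`), and satisfies `S (q l x) = q l (S l x)` — is an antipode for
the bialgebra `H`, i.e. `m ∘ (id ⊗ S) ∘ Δ = m ∘ (S ⊗ id) ∘ Δ = η ∘ ε`; hence `H` is a Hopf
algebra. -/
theorem antipode_on_bialgebra_coproduct_of_hopf (k : Type u) [Field k] {ι : Type u}
    (Hl : ι → Type u) [∀ l, Ring (Hl l)] [∀ l, HopfAlgebra k (Hl l)]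
    (H : Type u) [Ring H] [instH : Bialgebra k H] (q : ∀ l : ι, Hl l →ₐc[k] H)
    (hcoprod : IsBialgCoproduct k Hl q)
    (S : H →ₗ[k] H)
    (hS1 : S 1 = 1)
    (hSmul : ∀ x y : H, S (x * y) = S y * S x)
    (hScounit : ∀ x : H, Coalgebra.counit (R := k) (S x) = Coalgebra.counit (R := k) x)
    (hScomul : Coalgebra.comul (R := k) ∘ₗ S =
      (TensorProduct.comm k H H).toLinearMap ∘ₗ TensorProduct.map S S ∘ₗ
        Coalgebra.comul (R := k))
    (hSq : ∀ (l : ι) (x : Hl l), S (q l x) = q l (HopfAlgebra.antipode (R := k) x)) :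
    (LinearMap.mul' k H ∘ₗ S.rTensor H ∘ₗ Coalgebra.comul =
        Algebra.linearMap k H ∘ₗ Coalgebra.counit) ∧
      (LinearMap.mul' k H ∘ₗ S.lTensor H ∘ₗ Coalgebra.comul =
        Algebra.linearMap k H ∘ₗ Coalgebra.counit) ∧
      ∃ hopf : HopfAlgebra k H, hopf.toBialgebra = instH ∧
        ∀ h : H, hopf.antipode h = S h := by
  have hgen := coprod_generated Hl q hcoprod
  have hqc : ∀ l x, TensorProduct.map (q l : Hl l →ₗ[k] H) (q l : Hl l →ₗ[k] H)
      (Coalgebra.comul (R := k) x) = Coalgebra.comul (R := k) (q l x) := fun l x =>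
    CoalgHomClass.map_comp_comul_apply (q l) x
  have hqe : ∀ l x, Coalgebra.counit (R := k) (q l x) = Coalgebra.counit (R := k) x :=
    fun l x => CoalgHomClass.counit_comp_apply (q l) x
  have hSa : ∀ r : k, S (algebraMap k H r) = algebraMap k H r := by
    intro r
    rw [Algebra.algebraMap_eq_smul_one, map_smul, hS1]
  have hL : LinearMap.mul' k H ∘ₗ S.rTensor H ∘ₗ Coalgebra.comul =
        Algebra.linearMap k H ∘ₗ Coalgebra.counit := by
    ext x
    have hx : x ∈ Algebra.adjoin k (⋃ l, Set.range (q l)) := hgen ▸ Algebra.mem_top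
    change LinearMap.mul' k H (S.rTensor H (Coalgebra.comul x)) =
      algebraMap k H (Coalgebra.counit x)
    induction hx using Algebra.adjoin_induction with
    | mem x hx =>
      obtain ⟨_, ⟨l, rfl⟩, x, rfl⟩ := hx
      have key : ∀ t : Hl l ⊗[k] Hl l, LinearMap.mul' k H (S.rTensor H
          (TensorProduct.map (q l : Hl l →ₗ[k] H) (q l : Hl l →ₗ[k] H) t)) =
          q l (LinearMap.mul' k (Hl l) ((HopfAlgebra.antipode k).rTensor (Hl l) t)) := by
        intro t
        induction t with
        | zero => simp
        | add x y hx hy => simp only [map_add, hx, hy]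
        | tmul a b => simp [hSq]
      rw [← hqc, key, HopfAlgebra.mul_antipode_rTensor_comul_apply, hqe]
      exact AlgHomClass.commutes (q l) _
    | algebraMap r => simp [Algebra.TensorProduct.algebraMap_apply, hSa]
    | add x y _ _ hx hy => simp only [map_add, hx, hy]
    | mul x y _ _ hx hy =>
      have key1 : ∀ (t : H ⊗[k] H) (c d : H), LinearMap.mul' k H (S.rTensor H (t * c ⊗ₜ d)) =
          S c * LinearMap.mul' k H (S.rTensor H t) * d := by
        intro t c d
        induction t with
        | zero => simp
        | add x y hx hy => simp only [map_add, hx, hy, add_mul, mul_add]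
        | tmul a b => simp [hSmul, mul_assoc]
      have key2 : ∀ u : H ⊗[k] H, LinearMap.mul' k H (S.rTensor H (Coalgebra.comul x * u)) =
          algebraMap k H (Coalgebra.counit x) * LinearMap.mul' k H (S.rTensor H u) := by
        intro u
        induction u with
        | zero => simp
        | add x y hx hy => simp only [map_add, hx, hy, mul_add]
        | tmul a b =>
          rw [key1, hx, ← Algebra.commutes, mul_assoc]; simp
      rw [Bialgebra.comul_mul, key2, hy, Bialgebra.counit_mul, map_mul]
  have hR : LinearMap.mul' k H ∘ₗ S.lTensor H ∘ₗ Coalgebra.comul =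
        Algebra.linearMap k H ∘ₗ Coalgebra.counit := by
    ext x
    have hx : x ∈ Algebra.adjoin k (⋃ l, Set.range (q l)) := hgen ▸ Algebra.mem_top
    change LinearMap.mul' k H (S.lTensor H (Coalgebra.comul x)) =
      algebraMap k H (Coalgebra.counit x)
    induction hx using Algebra.adjoin_induction with
    | mem x hx =>
      obtain ⟨_, ⟨l, rfl⟩, x, rfl⟩ := hx
      have key : ∀ t : Hl l ⊗[k] Hl l, LinearMap.mul' k H (S.lTensor H
          (TensorProduct.map (q l : Hl l →ₗ[k] H) (q l : Hl l →ₗ[k] H) t)) =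
          q l (LinearMap.mul' k (Hl l) ((HopfAlgebra.antipode k).lTensor (Hl l) t)) := by
        intro t
        induction t with
        | zero => simp
        | add x y hx hy => simp only [map_add, hx, hy]
        | tmul a b => simp [hSq]
      rw [← hqc, key, HopfAlgebra.mul_antipode_lTensor_comul_apply, hqe]
      exact AlgHomClass.commutes (q l) _
    | algebraMap r => simp [Algebra.TensorProduct.algebraMap_apply, hS1]
    | add x y _ _ hx hy => simp only [map_add, hx, hy]
    | mul x y _ _ hx hy =>
      have key1 : ∀ (t : H ⊗[k] H) (c d : H), LinearMap.mul' k H (S.lTensor H (c ⊗ₜ d * t)) =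
          c * LinearMap.mul' k H (S.lTensor H t) * S d := by
        intro t c d
        induction t with
        | zero => simp
        | add x y hx hy => simp only [map_add, hx, hy, add_mul, mul_add]
        | tmul a b => simp [hSmul, mul_assoc]
      have key2 : ∀ u : H ⊗[k] H, LinearMap.mul' k H (S.lTensor H (u * Coalgebra.comul y)) =
          LinearMap.mul' k H (S.lTensor H u) * algebraMap k H (Coalgebra.counit y) := by
        intro u
        induction u with
        | zero => simp
        | add x y hx hy => simp only [map_add, hx, hy, add_mul]
        | tmul a b =>
          rw [key1, hy, mul_assoc, Algebra.commutes, ← mul_assoc]; simp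
      rw [Bialgebra.comul_mul, key2, hx, Bialgebra.counit_mul, map_mul]
  exact ⟨hL, hR, { instH with
    antipode := S
    mul_antipode_rTensor_comul := hL
    mul_antipode_lTensor_comul := hR }, rfl, fun _ => rfl⟩
end
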